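/- (Consequence of Theorem 1 stated in Section 1.3) For every c > 0 there exists a constant C > 0 (depending only on c) such that the following holds for all N ≥ 2: if x_1, …, x_N ∈ 𝕋² are points such that for every center x ∈ 𝕋² and every radius r ∈ {1/4, 1/2}, the closed metric ball D = {y ∈ 𝕋² : ‖y − x‖ ≤ r} satisfies |#{1 ≤ i ≤ N : x_i ∈ D} − N·πr²| ≤ c · N^{1/4} √(log N), then Σ_{i,j=1}^N 1 / (1 + N² ‖x_i − x_j‖⁴) ≤ C · N log N. -/

import Mathlib

open scoped Real BigOperators

noncomputable section

/-- The `d`-dimensional torus `ℝ^d/ℤ^d`. -/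
abbrev Torus (d : ℕ) := Fin d → AddCircle (1 : ℝ)

/-- The torus (Euclidean) distance `min_{m ∈ ℤ^d} |x - y - m|`. -/
def torusDist {d : ℕ} (x y : Torus d) : ℝ := Real.sqrt (∑ m, ‖x m - y m‖ ^ 2)

open MeasureTheory Set Filter Topology

/-- Branch of the square root of `1 - w²` used for the contour argument. -/
def sqF (w : ℂ) : ℂ := (1 - w ^ 2) ^ (((2 : ℕ) : ℂ)⁻¹)

lemma sqF_sq (w : ℂ) : sqF w ^ 2 = 1 - w ^ 2 := Complex.cpow_nat_inv_pow _ two_ne_zero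

lemma half_re_pos : 0 < ((((2 : ℕ) : ℂ)⁻¹)).re := by
  norm_num

lemma re_one_sub_sq (w : ℂ) : (1 - w ^ 2).re = 1 - w.re ^ 2 + w.im ^ 2 := by
  simp [sq]; ring

lemma sqF_continuousAt {w : ℂ} (h : w.re ^ 2 ≤ 1) : ContinuousAt sqF w := by
  have h1 : ContinuousAt (fun x : ℂ => x ^ (((2 : ℕ) : ℂ)⁻¹)) (1 - w ^ 2) := by
    apply Complex.continuousAt_cpow_const_of_re_pos _ half_re_pos
    left
    rw [re_one_sub_sq]
    nlinarith [sq_nonneg w.im]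
  exact ContinuousAt.comp (f := fun w : ℂ => 1 - w ^ 2) h1 (by fun_prop)

lemma sqF_differentiableAt {w : ℂ} (h : w.re ^ 2 < 1) : DifferentiableAt ℂ sqF w := by
  unfold sqF
  apply DifferentiableAt.cpow_const
  · fun_prop
  · left
    rw [re_one_sub_sq]
    nlinarith [sq_nonneg w.im]

lemma sqF_norm (w : ℂ) : ‖sqF w‖ ^ 2 ≤ 1 + ‖w‖ ^ 2 := by
  rw [← norm_pow, sqF_sq]
  refine (norm_sub_le _ _).trans ?_
  simp

/-- real part of a complex square root is nonnegative -/
lemma half_cpow_re_nonneg (x : ℂ) : 0 ≤ (x ^ (((2 : ℕ) : ℂ)⁻¹)).re := by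
  have := Complex.abs_arg_le_pi_div_two_iff (z := x ^ (((2 : ℕ) : ℂ)⁻¹))
  rw [← this]
  by_cases hx : x = 0
  · subst hx; simp; positivity
  rw [Complex.cpow_def_of_ne_zero hx]
  rw [Complex.arg_exp]
  have h1 : (Complex.log x * (((2 : ℕ) : ℂ)⁻¹)).im = x.arg / 2 := by
    have : (((2 : ℕ) : ℂ)⁻¹) = ((1/2 : ℝ) : ℂ) := by norm_num
    rw [this, Complex.im_mul_ofReal, Complex.log_im]; ring
  rw [h1]
  have h2 := Complex.neg_pi_lt_arg x
  have h3 := Complex.arg_le_pi x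
  have : toIocMod Real.two_pi_pos (-π) (x.arg / 2) = x.arg / 2 := by
    rw [toIocMod_eq_self]
    constructor <;> linarith
  rw [this, abs_le]
  constructor <;> linarith

lemma sqF_re_nonneg (w : ℂ) : 0 ≤ (sqF w).re := half_cpow_re_nonneg _

lemma sqF_real {t : ℝ} (h : t ^ 2 ≤ 1) : sqF t = (Real.sqrt (1 - t ^ 2) : ℝ) := by
  have h1 : (1 - (t:ℂ) ^ 2) = ((1 - t ^ 2 : ℝ) : ℂ) := by push_cast; ring
  rw [sqF, h1]
  have : (((2 : ℕ) : ℂ)⁻¹) = ((1/2 : ℝ) : ℂ) := by norm_num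
  rw [this, ← Complex.ofReal_cpow (by linarith), Real.sqrt_eq_rpow]

/-- values on the right vertical side -/
def pp (s : ℝ) : ℝ := (sqF (1 + s * Complex.I)).re
def qq (s : ℝ) : ℝ := -(sqF (1 + s * Complex.I)).im

lemma sqF_right (s : ℝ) : sqF (1 + s * Complex.I) = pp s - qq s * Complex.I := by
  apply Complex.ext <;> simp [pp, qq]

lemma sqF_left {s : ℝ} (hs : 0 < s) : sqF (-1 + s * Complex.I) = pp s + qq s * Complex.I := by
  have h : sqF (-1 + s * Complex.I) = (starRingEnd ℂ) (sqF (1 + s * Complex.I)) := by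
    unfold sqF
    have h1 : (1 - (-1 + s * Complex.I) ^ 2 : ℂ) = (starRingEnd ℂ) (1 - (1 + s * Complex.I) ^ 2) := by
      simp
      ring_nf
    rw [h1, Complex.conj_cpow]
    · rw [map_inv₀, map_natCast]
    · intro hh
      rw [Complex.arg_eq_pi_iff, re_one_sub_sq] at hh
      have := hh.1
      simp at this
      nlinarith
  rw [h, sqF_right]
  simp

lemma pq_eqs (s : ℝ) : pp s ^ 2 - qq s ^ 2 = s ^ 2 ∧ pp s * qq s = s := by
  have h := sqF_sq (1 + s * Complex.I)
  rw [sqF_right] at h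
  have hr := congrArg Complex.re h
  have hi := congrArg Complex.im h
  simp [sq] at hr hi
  constructor <;> nlinarith

/-- rotated components -/
def al (s : ℝ) : ℝ := (pp s + qq s) / √2
def be (s : ℝ) : ℝ := (pp s - qq s) / √2

lemma al_be {s : ℝ} (hs : 0 < s) :
    0 ≤ be s ∧ √2 * s ^ ((1:ℝ)/2) ≤ al s ∧ be s ≤ s ^ ((3:ℝ)/2) / (2 * √2) := by
  obtain ⟨h1, h2⟩ := pq_eqs s
  have hp : 0 ≤ pp s := sqF_re_nonneg _
  have hp' : 0 < pp s := by
    rcases hp.eq_or_lt with h | h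
    · rw [← h] at h2; linarith [zero_mul (qq s)]
    · exact h
  have hq : 0 < qq s := by
    by_contra hh
    push Not at hh
    nlinarith
  have hr2 : √2 ^ 2 = 2 := Real.sq_sqrt (by norm_num)
  have hr : 0 < √2 := by positivity
  have ha : 0 < al s := by unfold al; positivity
  have e1 : al s ^ 2 - be s ^ 2 = 2 * s := by
    unfold al be; field_simp; rw [hr2]; linarith
  have e2 : 2 * al s * be s = s ^ 2 := by
    unfold al be; field_simp; rw [hr2]; linarith
  have hb : 0 ≤ be s := by
    by_contra hh
    push Not at hh
    nlinarith
  have hsh : s ^ ((1:ℝ)/2) = √s := by rw [Real.sqrt_eq_rpow]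
  have hs3 : s ^ ((3:ℝ)/2) = s * √s := by
    rw [show (3:ℝ)/2 = 1 + 1/2 by norm_num, Real.rpow_add hs, Real.rpow_one, hsh]
  have hss : √s ^ 2 = s := Real.sq_sqrt hs.le
  have hsp : 0 < √s := by positivity
  have hal : √2 * √s ≤ al s := by
    apply le_of_sq_le_sq _ ha.le
    rw [mul_pow, hr2, hss]; nlinarith [sq_nonneg (be s)]
  refine ⟨hb, by rwa [hsh], ?_⟩
  rw [hs3, le_div_iff₀ (by positivity)]
  have : 2 * (√2 * √s) * be s ≤ s * (√s)^2 := by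
    rw [hss]
    nlinarith
  have h5 : √s * (be s * (2 * √2)) ≤ √s * (s * √s) := by nlinarith
  exact le_of_mul_le_mul_left h5 hsp

lemma sqF_norm_le {e s : ℝ} (he : e ^ 2 ≤ 1) (hs : 0 ≤ s) :
    ‖sqF (e + s * Complex.I)‖ ≤ 2 + s := by
  have h := sqF_norm (e + s * Complex.I)
  have h2 : ‖(e + s * Complex.I : ℂ)‖ ^ 2 = e ^ 2 + s ^ 2 := by
    rw [← Complex.normSq_eq_norm_sq, Complex.normSq_add_mul_I]
  rw [h2] at h
  apply le_of_sq_le_sq _ (by positivity)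
  nlinarith

lemma integrable_lin_exp {z : ℝ} (hz : 0 < z) :
    IntegrableOn (fun s : ℝ => (2 + s) * Real.exp (-(z * s))) (Ioi 0) := by
  have h0 := integrableOn_rpow_mul_exp_neg_mul_rpow (p := 1) (s := 0) (b := z) (by norm_num) one_pos hz
  have h1 := integrableOn_rpow_mul_exp_neg_mul_rpow (p := 1) (s := 1) (b := z) (by norm_num) one_pos hz
  refine ((h0.const_mul 2).add h1).congr ?_
  refine (ae_of_all _ fun s => ?_)
  simp
  ring

def gK (z : ℝ) : ℝ := ∫ t in (-1:ℝ)..1, √(1 - t ^ 2) * Real.cos (z * t)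

def GG (z : ℝ) (w : ℂ) : ℂ := sqF w * Complex.exp (Complex.I * z * w)

lemma norm_GG (z e s : ℝ) : ‖GG z (e + s * Complex.I)‖ =
    ‖sqF (e + s * Complex.I)‖ * Real.exp (-(z * s)) := by
  rw [GG, norm_mul, Complex.norm_exp]
  simp

lemma GG_integrable {z : ℝ} (hz : 0 < z) {e : ℝ} (he : e ^ 2 ≤ 1) :
    IntegrableOn (fun s : ℝ => GG z (e + s * Complex.I)) (Ioi 0) := by
  refine Integrable.mono' (integrable_lin_exp hz) ?_ ?_
  · apply Continuous.aestronglyMeasurable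
    unfold GG
    refine Continuous.mul ?_ (by fun_prop)
    rw [continuous_iff_continuousAt]
    intro s
    refine ContinuousAt.comp (f := fun s : ℝ => (e + s * Complex.I : ℂ)) (g := sqF) ?_ (by fun_prop)
    apply sqF_continuousAt
    simpa using he
  · refine (ae_restrict_mem measurableSet_Ioi).mono fun s hs => ?_
    rw [norm_GG]
    gcongr
    exact sqF_norm_le he (le_of_lt hs)

lemma GG_rect (z T : ℝ) (hT : 0 < T) :
    (∫ x in (-1:ℝ)..1, GG z x) - (∫ x in (-1:ℝ)..1, GG z (x + T * Complex.I))
    + Complex.I * (∫ s in (0:ℝ)..T, GG z ((1:ℝ) + s * Complex.I))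
    - Complex.I * (∫ s in (0:ℝ)..T, GG z ((-1:ℝ) + s * Complex.I)) = 0 := by
  have := Complex.integral_boundary_rect_eq_zero_of_continuousOn_of_differentiableOn
    (GG z) (-1) (1 + T * Complex.I) ?_ ?_
  · simpa using this
  · intro w hw
    have hw1 := hw.1
    simp at hw1
    apply ContinuousAt.continuousWithinAt
    unfold GG
    refine ContinuousAt.mul (sqF_continuousAt ?_) (by fun_prop)
    nlinarith [hw1.1, hw1.2]
  · intro w hw
    have hw1 := hw.1
    simp at hw1
    apply DifferentiableAt.differentiableWithinAt
    unfold GG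
    refine DifferentiableAt.mul (sqF_differentiableAt ?_) (by fun_prop)
    nlinarith [hw1.1, hw1.2]

lemma GG_top {z : ℝ} (hz : 0 < z) :
    Tendsto (fun T : ℝ => ∫ x in (-1:ℝ)..1, GG z (x + T * Complex.I)) atTop (𝓝 0) := by
  have hlim : Tendsto (fun T : ℝ => (2 + T) * Real.exp (-(z * T)) * 2) atTop (𝓝 0) := by
    have h0 := Real.tendsto_pow_mul_exp_neg_atTop_nhds_zero 0
    have h1 := Real.tendsto_pow_mul_exp_neg_atTop_nhds_zero 1
    have hm : Tendsto (fun T : ℝ => z * T) atTop atTop := tendsto_id.const_mul_atTop hz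
    have := (((h0.comp hm).const_mul 4).add ((h1.comp hm).const_mul (2 / z)))
    simp only [mul_zero, add_zero] at this
    refine this.congr fun T => ?_
    simp only [Function.comp]
    field_simp
    ring
  refine squeeze_zero_norm' ?_ hlim
  filter_upwards [eventually_ge_atTop 0] with T hT
  have := intervalIntegral.norm_integral_le_of_norm_le_const (a := (-1:ℝ)) (b := 1)
    (f := fun x : ℝ => GG z (x + T * Complex.I)) (C := (2 + T) * Real.exp (-(z * T))) ?_
  · refine this.trans_eq ?_
    norm_num
  · intro x hx
    rw [uIoc_of_le (by norm_num)] at hx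
    rw [norm_GG]
    gcongr
    exact sqF_norm_le (by nlinarith [hx.1, hx.2]) hT

lemma GG_eq {z : ℝ} (hz : 0 < z) :
    (∫ x in (-1:ℝ)..1, GG z x) = Complex.I * (∫ s in Ioi (0:ℝ), GG z ((-1:ℝ) + s * Complex.I))
     - Complex.I * (∫ s in Ioi (0:ℝ), GG z ((1:ℝ) + s * Complex.I)) := by
  have hR := (intervalIntegral_tendsto_integral_Ioi 0
    (GG_integrable hz (e := 1) (by norm_num)) tendsto_id).const_mul Complex.I
  have hL := (intervalIntegral_tendsto_integral_Ioi 0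
    (GG_integrable hz (e := -1) (by norm_num)) tendsto_id).const_mul Complex.I
  have h := (hL.sub hR).add (GG_top hz)
  rw [add_zero] at h
  refine tendsto_nhds_unique (tendsto_const_nhds.congr' ?_) h
  filter_upwards [eventually_gt_atTop 0] with T hT
  have := GG_rect z T hT
  simp only [id]
  linear_combination this

lemma gK_eq {z : ℝ} (hz : 0 < z) : gK z = 2 * ∫ s in Ioi (0:ℝ),
    (al s * Real.sin (z - π / 4) + be s * Real.cos (z - π / 4)) * Real.exp (-(z * s)) := by
  have h := GG_eq hz
  rw [← mul_sub, ← integral_sub (GG_integrable hz (by norm_num)) (GG_integrable hz (by norm_num)),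
    ← integral_const_mul] at h
  have h1 : gK z = (∫ x in (-1:ℝ)..1, GG z x).re := by
    have hIntg : IntervalIntegrable (fun x : ℝ => GG z x) volume (-1) 1 := by
      apply ContinuousOn.intervalIntegrable
      intro x hx
      rw [uIcc_of_le (by norm_num)] at hx
      apply ContinuousAt.continuousWithinAt
      unfold GG
      refine ContinuousAt.mul ?_ (by fun_prop)
      refine ContinuousAt.comp (f := fun s : ℝ => (s : ℂ)) (g := sqF) ?_ (by fun_prop)
      apply sqF_continuousAt
      simp only [Complex.ofReal_re]
      nlinarith [hx.1, hx.2]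
    have h2 := Complex.reCLM.intervalIntegral_comp_comm hIntg
    simp only [Complex.reCLM_apply] at h2
    rw [← h2, gK]
    apply intervalIntegral.integral_congr
    intro x hx
    rw [uIcc_of_le (by norm_num)] at hx
    simp only [GG]
    rw [sqF_real (by nlinarith [hx.1, hx.2]), Complex.re_ofReal_mul]
    congr 1
    rw [show Complex.I * z * x = ((z * x : ℝ) : ℂ) * Complex.I by push_cast; ring,
      Complex.exp_ofReal_mul_I_re]
  rw [h1, h, ← integral_const_mul]
  have h3 : ∀ s ∈ Ioi (0:ℝ), Complex.I * (GG z ((-1:ℝ) + s * Complex.I) - GG z ((1:ℝ) + s * Complex.I))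
    = ((2 * ((al s * Real.sin (z - π / 4) + be s * Real.cos (z - π / 4)) * Real.exp (-(z * s))) : ℝ) : ℂ) := by
    intro s hs
    have e1 : Complex.exp (Complex.I * z * ((-1:ℝ) + s * Complex.I)) =
        (Real.cos z - Real.sin z * Complex.I) * Real.exp (-(z * s)) := by
      rw [show Complex.I * z * ((-1:ℝ) + s * Complex.I) = ((-z : ℝ) : ℂ) * Complex.I + ((-(z * s) : ℝ) : ℂ) by
        push_cast; linear_combination (z * s : ℂ) * Complex.I_sq]
      rw [Complex.exp_add, Complex.exp_mul_I, ← Complex.ofReal_exp, ← Complex.ofReal_cos,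
        ← Complex.ofReal_sin, Real.cos_neg, Real.sin_neg]
      push_cast; ring
    have e2 : Complex.exp (Complex.I * z * ((1:ℝ) + s * Complex.I)) =
        (Real.cos z + Real.sin z * Complex.I) * Real.exp (-(z * s)) := by
      rw [show Complex.I * z * ((1:ℝ) + s * Complex.I) = ((z : ℝ) : ℂ) * Complex.I + ((-(z * s) : ℝ) : ℂ) by
        push_cast; linear_combination (z * s : ℂ) * Complex.I_sq]
      rw [Complex.exp_add, Complex.exp_mul_I, ← Complex.ofReal_exp, ← Complex.ofReal_cos,
        ← Complex.ofReal_sin]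
    have e3 : al s * Real.sin (z - π / 4) + be s * Real.cos (z - π / 4) =
        pp s * Real.sin z - qq s * Real.cos z := by
      rw [Real.sin_sub, Real.cos_sub, Real.cos_pi_div_four, Real.sin_pi_div_four]
      unfold al be
      have hr2 : √2 ^ 2 = 2 := Real.sq_sqrt (by norm_num)
      have hr : 0 < √2 := by positivity
      field_simp
      ring
    rw [e3]
    simp only [GG]
    rw [e1, e2]
    have f1 := sqF_left hs
    have f2 := sqF_right s
    rw [show (((-1:ℝ) : ℂ) + s * Complex.I) = -1 + s * Complex.I by push_cast; ring,
      show (((1:ℝ) : ℂ) + s * Complex.I) = 1 + s * Complex.I by push_cast; ring, f1, f2]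
    push_cast
    linear_combination (2 * (qq s * Complex.cos z - pp s * Complex.sin z) * Complex.exp (-(z * s)) : ℂ) * Complex.I_sq
  rw [setIntegral_congr_fun measurableSet_Ioi h3, integral_complex_ofReal, Complex.ofReal_re]


lemma pq_cont : Continuous pp ∧ Continuous qq := by
  have h : Continuous (fun s : ℝ => sqF (1 + s * Complex.I)) := by
    rw [continuous_iff_continuousAt]
    intro s
    refine ContinuousAt.comp (f := fun s : ℝ => (1 + s * Complex.I : ℂ)) (g := sqF) ?_ (by fun_prop)
    apply sqF_continuousAt
    simp
  exact ⟨Complex.continuous_re.comp h, (Complex.continuous_im.comp h).neg⟩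

lemma pq_integrable {z : ℝ} (hz : 0 < z) :
    IntegrableOn (fun s => pp s * Real.exp (-(z * s))) (Ioi 0) ∧
    IntegrableOn (fun s => qq s * Real.exp (-(z * s))) (Ioi 0) := by
  have key : ∀ f : ℝ → ℝ, Continuous f → (∀ s, |f s| ≤ ‖sqF (1 + s * Complex.I)‖) →
      IntegrableOn (fun s => f s * Real.exp (-(z * s))) (Ioi 0) := by
    intro f hf hb
    refine Integrable.mono' (integrable_lin_exp hz) ?_ ?_
    · apply Continuous.aestronglyMeasurable
      fun_prop
    · refine (ae_restrict_mem measurableSet_Ioi).mono fun s hs => ?_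
      rw [norm_mul, Real.norm_eq_abs, Real.norm_eq_abs, Real.abs_exp]
      gcongr
      refine (hb s).trans ?_
      have := sqF_norm_le (e := 1) (s := s) (by norm_num) (le_of_lt hs)
      simpa using this
  refine ⟨key _ pq_cont.1 fun s => ?_, key _ pq_cont.2 fun s => ?_⟩
  · exact Complex.abs_re_le_norm _
  · unfold qq
    rw [abs_neg]
    exact Complex.abs_im_le_norm _

lemma albe_integrable {z : ℝ} (hz : 0 < z) :
    IntegrableOn (fun s => al s * Real.exp (-(z * s))) (Ioi 0) ∧
    IntegrableOn (fun s => be s * Real.exp (-(z * s))) (Ioi 0) := by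
  obtain ⟨h1, h2⟩ := pq_integrable hz
  refine ⟨((h1.add h2).div_const (√2)).congr (ae_of_all _ fun s => ?_),
    ((h1.sub h2).div_const (√2)).congr (ae_of_all _ fun s => ?_)⟩
  · simp [al]; ring
  · simp [be]; ring

/-- main-term size -/
def MM (z : ℝ) : ℝ := √2 * ((1 / z) ^ ((3:ℝ)/2) * Real.Gamma (3/2))

lemma gK_repr {z : ℝ} (hz : 0 < z) : ∃ A B : ℝ,
    gK z = 2 * (A * Real.sin (z - π / 4) + B * Real.cos (z - π / 4)) ∧ MM z ≤ A ∧ 0 ≤ B ∧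
    B ≤ 3 / (8 * z) * MM z := by
  obtain ⟨h1, h2⟩ := albe_integrable hz
  have hpow : ∀ p : ℝ, 0 < p → IntegrableOn (fun s : ℝ => s ^ (p - 1) * Real.exp (-(z * s))) (Ioi 0) := by
    intro p hp
    refine (integrableOn_rpow_mul_exp_neg_mul_rpow (p := 1) (s := p - 1) (b := z) (by linarith)
      one_pos hz).congr (ae_of_all _ fun s => ?_)
    simp
  refine ⟨∫ s in Ioi (0:ℝ), al s * Real.exp (-(z * s)), ∫ s in Ioi (0:ℝ), be s * Real.exp (-(z * s)),
    ?_, ?_, ?_, ?_⟩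
  · rw [gK_eq hz, ← integral_mul_const, ← integral_mul_const, ← integral_add (h1.mul_const _) (h2.mul_const _)]
    congr 1
    apply integral_congr_ae
    exact ae_of_all _ fun s => by simp only; ring
  · rw [MM, ← Real.integral_rpow_mul_exp_neg_mul_Ioi (by norm_num) hz, ← integral_const_mul]
    refine setIntegral_mono_on ((hpow (3/2) (by norm_num)).const_mul _) h1 measurableSet_Ioi fun s hs => ?_
    rw [← mul_assoc]
    gcongr
    have := (al_be hs).2.1
    norm_num at this ⊢
    exact this
  · refine setIntegral_nonneg measurableSet_Ioi fun s hs => ?_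
    have := (al_be hs).1
    positivity
  · have e : 3 / (8 * z) * MM z = 1 / (2 * √2) * ((1 / z) ^ ((5:ℝ)/2) * Real.Gamma (5/2)) := by
      rw [MM, show (5:ℝ)/2 = 3/2 + 1 by norm_num, Real.Gamma_add_one (by norm_num),
        Real.rpow_add (by positivity), Real.rpow_one]
      have hr2 : √2 ^ 2 = 2 := Real.sq_sqrt (by norm_num)
      field_simp
      rw [hr2]
      norm_num
    rw [e, ← Real.integral_rpow_mul_exp_neg_mul_Ioi (by norm_num) hz, ← integral_const_mul]
    refine setIntegral_mono_on h2 ((hpow (5/2) (by norm_num)).const_mul _) measurableSet_Ioi fun s hs => ?_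
    rw [← mul_assoc]
    gcongr
    have := (al_be hs).2.2
    rw [show (5:ℝ)/2 - 1 = 3/2 by norm_num]
    refine this.trans_eq ?_
    ring

lemma trig_lower {M A B M' A' B' ψ : ℝ} (hM : 0 < M) (hM' : 0 < M') (hA : M ≤ A) (hB0 : 0 ≤ B)
    (hB : B ≤ 0.24 * M) (hA' : M' ≤ A') (hB0' : 0 ≤ B') (hB' : B' ≤ 0.12 * M')
    (h : |A * Real.sin ψ + B * Real.cos ψ| < 0.04 * M) :
    0.04 * M' ≤ A' * Real.sin (2 * ψ + π / 4) + B' * Real.cos (2 * ψ + π / 4) := by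
  rw [abs_lt] at h
  have hc1 := Real.cos_le_one ψ
  have hc2 := Real.neg_one_le_cos ψ
  have hss := Real.sin_sq_add_cos_sq ψ
  rw [Real.sin_add, Real.cos_add, Real.sin_two_mul, Real.cos_two_mul, Real.cos_pi_div_four,
    Real.sin_pi_div_four]
  set s := Real.sin ψ
  set c := Real.cos ψ
  have hBc : |B * c| ≤ 0.24 * M := by
    rw [abs_le]; constructor <;> nlinarith
  rw [abs_le] at hBc
  have hs1 : s ≤ 0.28 := by
    by_contra hh
    push Not at hh
    nlinarith
  have hs2 : -0.28 ≤ s := by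
    by_contra hh
    push Not at hh
    nlinarith
  have hsc : |s * c| ≤ 0.28 := by
    rw [abs_mul]
    have : |s| ≤ 0.28 := abs_le.2 ⟨hs2, hs1⟩
    have : |c| ≤ 1 := abs_le.2 ⟨hc2, hc1⟩
    nlinarith [abs_nonneg s, abs_nonneg c]
  rw [abs_le] at hsc
  have hcc : c ^ 2 ≥ 1 - 0.28 ^ 2 := by nlinarith
  have hcc' : c ^ 2 ≤ 1 := by nlinarith
  have hr : √2 ^ 2 = 2 := Real.sq_sqrt (by norm_num)
  have hr0 : 1.4 < √2 := by
    apply Real.lt_sqrt_of_sq_lt; norm_num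
  set S := 2 * s * c + (2 * c ^ 2 - 1) with hS
  set D := (2 * c ^ 2 - 1) - 2 * s * c with hD
  have hS1 : 0.28 ≤ S := by rw [hS]; nlinarith
  have hD1 : |D| ≤ 1.56 := by rw [hD, abs_le]; constructor <;> nlinarith
  rw [abs_le] at hD1
  have h1 : 0.28 * M' ≤ A' * S := by nlinarith
  have h2 : -(0.12 * 1.56) * M' ≤ B' * D := by nlinarith
  have e : A' * (2 * s * c * (√2 / 2) + (2 * c ^ 2 - 1) * (√2 / 2)) +
      B' * ((2 * c ^ 2 - 1) * (√2 / 2) - 2 * s * c * (√2 / 2)) = (√2 / 2) * (A' * S + B' * D) := by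
    rw [hS, hD]; ring
  rw [e]
  have h3 : 0.09 * M' ≤ A' * S + B' * D := by linarith
  nlinarith

lemma gK_lower : ∃ c0 : ℝ, 0 < c0 ∧ ∀ z : ℝ, π / 2 ≤ z → c0 / z ^ 3 ≤ gK z ^ 2 + gK (2 * z) ^ 2 := by
  have hΓ : 0 < Real.Gamma (3/2) := Real.Gamma_pos_of_pos (by norm_num)
  refine ⟨0.0064 * 2 * Real.Gamma (3/2) ^ 2 / 8, by positivity, fun z hz => ?_⟩
  have hz0 : 0 < z := by linarith [Real.pi_pos]
  have hz1 : 1.57 < z := by linarith [Real.pi_gt_d2]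
  have hMpos : ∀ z : ℝ, 0 < z → 0 < MM z := fun z hz => by unfold MM; positivity
  have hMsq : ∀ z : ℝ, 0 < z → MM z ^ 2 = 2 * Real.Gamma (3/2) ^ 2 / z ^ 3 := by
    intro z hz
    unfold MM
    rw [mul_pow, mul_pow, Real.sq_sqrt (by norm_num), ← Real.rpow_natCast ((1 / z) ^ ((3:ℝ)/2)) 2,
      ← Real.rpow_mul (by positivity)]
    norm_num
    ring
  obtain ⟨A, B, h1, h2, h3, h4⟩ := gK_repr hz0
  obtain ⟨A', B', h1', h2', h3', h4'⟩ := gK_repr (z := 2 * z) (by linarith)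
  have hM := hMpos z hz0
  have hM' := hMpos (2 * z) (by linarith)
  have hb : B ≤ 0.24 * MM z := by
    refine h4.trans ?_
    gcongr
    rw [div_le_iff₀ (by positivity)]; linarith
  have hb' : B' ≤ 0.12 * MM (2 * z) := by
    refine h4'.trans ?_
    gcongr
    rw [div_le_iff₀ (by positivity)]; linarith
  by_cases hc : |A * Real.sin (z - π / 4) + B * Real.cos (z - π / 4)| < 0.04 * MM z
  · have := trig_lower hM hM' h2 h3 hb h2' h3' hb' hc
    rw [show 2 * (z - π / 4) + π / 4 = 2 * z - π / 4 by ring] at this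
    have h5 : 0.08 * MM (2 * z) ≤ gK (2 * z) := by rw [h1']; linarith
    have h6 : (0.08 * MM (2 * z)) ^ 2 ≤ gK (2 * z) ^ 2 := by gcongr
    rw [mul_pow, hMsq _ (by linarith)] at h6
    have e : 0.0064 * 2 * Real.Gamma (3/2) ^ 2 / 8 / z ^ 3 =
        0.08 ^ 2 * (2 * Real.Gamma (3 / 2) ^ 2 / (2 * z) ^ 3) := by
      field_simp; norm_num
    rw [e]
    nlinarith [sq_nonneg (gK z)]
  · push Not at hc
    have h5 : 0.08 * MM z ≤ |gK z| := by
      rw [h1, abs_mul, abs_two]; linarith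
    have h6 : (0.08 * MM z) ^ 2 ≤ |gK z| ^ 2 := by gcongr
    rw [mul_pow, hMsq _ hz0, sq_abs] at h6
    have e : 0.0064 * 2 * Real.Gamma (3/2) ^ 2 / 8 / z ^ 3 ≤
        0.08 ^ 2 * (2 * Real.Gamma (3 / 2) ^ 2 / z ^ 3) := by
      have : 0 ≤ Real.Gamma (3 / 2) ^ 2 / z ^ 3 := by positivity
      have e2 : 0.0064 * 2 * Real.Gamma (3/2) ^ 2 / 8 / z ^ 3 =
        (0.0064 * 2 / 8) * (Real.Gamma (3 / 2) ^ 2 / z ^ 3) := by ring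
      rw [e2, show 0.08 ^ 2 * (2 * Real.Gamma (3 / 2) ^ 2 / z ^ 3) =
        (0.08 ^ 2 * 2) * (Real.Gamma (3 / 2) ^ 2 / z ^ 3) by ring]
      gcongr
      norm_num
    nlinarith [sq_nonneg (gK (2 * z))]


lemma gK_eq_integral (z : ℝ) : gK z = ∫ t : ℝ, √(1 - t ^ 2) * Real.cos (z * t) := by
  rw [gK, intervalIntegral.integral_of_le (by norm_num)]
  apply setIntegral_eq_integral_of_forall_compl_eq_zero
  intro t ht
  rw [Real.sqrt_eq_zero_of_nonpos, zero_mul]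
  by_contra hh
  push Not at hh
  apply ht
  have : |t| < 1 := by
    rw [← sq_lt_one_iff_abs_lt_one]; linarith
  rw [abs_lt] at this
  exact ⟨this.1, this.2.le⟩

lemma disc_prod {r K : ℝ} (hr : 0 < r) :
    ∫ p : ℝ × ℝ, {p : ℝ × ℝ | p.1 ^ 2 + p.2 ^ 2 ≤ r ^ 2}.indicator
      (fun p => Real.cos (2 * π * K * p.1)) p = 2 * r ^ 2 * gK (2 * π * r * K) := by
  have hmeas : MeasurableSet {p : ℝ × ℝ | p.1 ^ 2 + p.2 ^ 2 ≤ r ^ 2} :=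
    measurableSet_le (by fun_prop) (by fun_prop)
  have hcompact : {p : ℝ × ℝ | p.1 ^ 2 + p.2 ^ 2 ≤ r ^ 2} ⊆ Icc (-r) r ×ˢ Icc (-r) r := by
    rintro ⟨a, b⟩ h
    simp only [mem_ofPred_eq] at h
    have ha : |a| ≤ r := abs_le_of_sq_le_sq (by nlinarith [sq_nonneg b]) hr.le
    have hb : |b| ≤ r := abs_le_of_sq_le_sq (by nlinarith [sq_nonneg a]) hr.le
    exact ⟨abs_le.1 ha, abs_le.1 hb⟩
  have hIntg : Integrable ({p : ℝ × ℝ | p.1 ^ 2 + p.2 ^ 2 ≤ r ^ 2}.indicator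
      (fun p => Real.cos (2 * π * K * p.1))) (volume.prod volume) := by
    rw [integrable_indicator_iff hmeas]
    refine IntegrableOn.mono_set ?_ hcompact
    apply ContinuousOn.integrableOn_compact
    · exact isCompact_Icc.prod isCompact_Icc
    · fun_prop
  rw [Measure.volume_eq_prod, integral_prod _ hIntg]
  have h1 : ∀ x : ℝ, ∫ y : ℝ, {p : ℝ × ℝ | p.1 ^ 2 + p.2 ^ 2 ≤ r ^ 2}.indicator
      (fun p => Real.cos (2 * π * K * p.1)) (x, y) = 2 * √(r ^ 2 - x ^ 2) * Real.cos (2 * π * K * x) := by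
    intro x
    by_cases hx : 0 ≤ r ^ 2 - x ^ 2
    · have : ∀ y : ℝ, {p : ℝ × ℝ | p.1 ^ 2 + p.2 ^ 2 ≤ r ^ 2}.indicator
        (fun p => Real.cos (2 * π * K * p.1)) (x, y) =
          (Icc (-√(r ^ 2 - x ^ 2)) (√(r ^ 2 - x ^ 2))).indicator (fun _ => Real.cos (2 * π * K * x)) y := by
        intro y
        simp only [indicator, mem_ofPred_eq, mem_Icc]
        have : x ^ 2 + y ^ 2 ≤ r ^ 2 ↔ (-√(r ^ 2 - x ^ 2) ≤ y ∧ y ≤ √(r ^ 2 - x ^ 2)) := by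
          rw [← Real.sq_le hx]
          constructor <;> intro h <;> linarith
        simp only [this]
      simp_rw [this]
      rw [integral_indicator_const _ measurableSet_Icc, Real.volume_real_Icc_of_le]
      · rw [smul_eq_mul]; ring
      · linarith [Real.sqrt_nonneg (r ^ 2 - x ^ 2)]
    · push Not at hx
      rw [Real.sqrt_eq_zero_of_nonpos hx.le]
      have : ∀ y : ℝ, {p : ℝ × ℝ | p.1 ^ 2 + p.2 ^ 2 ≤ r ^ 2}.indicator
        (fun p => Real.cos (2 * π * K * p.1)) (x, y) = 0 := by
        intro y
        apply indicator_of_notMem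
        simp only [mem_ofPred_eq, not_le]
        nlinarith [sq_nonneg y]
      simp [this]
  simp_rw [h1]
  have h2 := Measure.integral_comp_mul_left (fun x => 2 * √(r ^ 2 - x ^ 2) * Real.cos (2 * π * K * x)) r
  have h3 : ∀ x : ℝ, 2 * √(r ^ 2 - (r * x) ^ 2) * Real.cos (2 * π * K * (r * x)) =
      2 * r * (√(1 - x ^ 2) * Real.cos (2 * π * r * K * x)) := by
    intro x
    rw [show r ^ 2 - (r * x) ^ 2 = r ^ 2 * (1 - x ^ 2) by ring, Real.sqrt_mul (by positivity),
      Real.sqrt_sq hr.le, show 2 * π * K * (r * x) = 2 * π * r * K * x by ring]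
    ring
  simp_rw [h3] at h2
  rw [integral_const_mul, ← gK_eq_integral, abs_of_pos (by positivity), smul_eq_mul] at h2
  field_simp at h2
  rw [← h2]; ring

lemma disc_pi {r : ℝ} (hr : 0 < r) (a b : ℝ) (hab : 0 < a ^ 2 + b ^ 2) :
    ∫ x : Fin 2 → ℝ, {x : Fin 2 → ℝ | x 0 ^ 2 + x 1 ^ 2 ≤ r ^ 2}.indicator
      (fun x => Real.cos (2 * π * (a * x 0 + b * x 1))) x = 2 * r ^ 2 * gK (2 * π * r * √(a ^ 2 + b ^ 2)) := by
  rw [← disc_prod hr]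
  rw [← Complex.volume_preserving_equiv_pi.integral_comp'
    (g := {x : Fin 2 → ℝ | x 0 ^ 2 + x 1 ^ 2 ≤ r ^ 2}.indicator
      (fun x => Real.cos (2 * π * (a * x 0 + b * x 1)))),
    ← Complex.volume_preserving_equiv_real_prod.integral_comp']
  set K := √(a ^ 2 + b ^ 2) with hK
  have hKp : 0 < K := Real.sqrt_pos.2 hab
  have hK2 : K ^ 2 = a ^ 2 + b ^ 2 := Real.sq_sqrt hab.le
  let κ : ℂ := ⟨a / K, b / K⟩
  have hκ : ‖κ‖ = 1 := by
    rw [← sq_eq_sq₀ (norm_nonneg _) zero_le_one, ← Complex.normSq_eq_norm_sq, Complex.normSq_mk]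
    field_simp
    linarith
  let u : Circle := ⟨κ, by simp [Submonoid.unitSphere, hκ]⟩
  have hrot := (rotation u).measurePreserving
  rw [← hrot.integral_comp (rotation u).toHomeomorph.measurableEmbedding]
  congr 1
  ext w
  have hu : (rotation u) w = κ * w := rotation_apply u w
  have e1 : ((rotation u) w).re = a / K * w.re - b / K * w.im := by rw [hu, Complex.mul_re]
  have e2 : ((rotation u) w).im = a / K * w.im + b / K * w.re := by rw [hu, Complex.mul_im]
  simp only [Complex.measurableEquivPi_apply, Complex.measurableEquivRealProd_apply, indicator,
    mem_ofPred_eq, Matrix.cons_val_zero, Matrix.cons_val_one, e1, e2]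
  have e3 : (a / K * w.re - b / K * w.im) ^ 2 + (a / K * w.im + b / K * w.re) ^ 2 = w.re ^ 2 + w.im ^ 2 := by
    have : (a / K) ^ 2 + (b / K) ^ 2 = 1 := by field_simp; linarith
    linear_combination (w.re ^ 2 + w.im ^ 2) * this
  have e4 : 2 * π * (a * (a / K * w.re - b / K * w.im) + b * (a / K * w.im + b / K * w.re)) =
      2 * π * K * w.re := by
    field_simp
    rw [hK2]
    ring_nf
  rw [e3, e4]
  by_cases hc : w.re ^ 2 + w.im ^ 2 ≤ r ^ 2
  · rw [if_pos hc]; exact (if_pos hc).symm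
  · rw [if_neg hc]; exact (if_neg hc).symm


section TorusPart

local instance instTorusMS : MeasureSpace UnitAddCircle := ⟨AddCircle.haarAddCircle⟩

local instance instTorusHaar : Measure.IsAddHaarMeasure (volume : Measure UnitAddCircle) :=
  inferInstanceAs (Measure.IsAddHaarMeasure AddCircle.haarAddCircle)

local instance instTorusProb : IsProbabilityMeasure (volume : Measure UnitAddCircle) :=
  inferInstanceAs (IsProbabilityMeasure AddCircle.haarAddCircle)

open UnitAddTorus

lemma bessel_torus (f : UnitAddTorus (Fin 2) → ℂ) (hf : Measurable f) {E : ℝ}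
    (hb : ∀ t, ‖f t‖ ≤ E) (F : Finset (Fin 2 → ℤ)) :
    ∑ k ∈ F, ‖mFourierCoeff f k‖ ^ 2 ≤ E ^ 2 := by
  have hLp : MemLp f 2 (volume : Measure (UnitAddTorus (Fin 2))) :=
    MemLp.of_bound hf.aestronglyMeasurable E (ae_of_all _ hb)
  have h := hasSum_sq_mFourierCoeff (hLp.toLp f)
  have h1 : ∀ k, mFourierCoeff (hLp.toLp f) k = mFourierCoeff f k := by
    intro k
    unfold mFourierCoeff
    apply integral_congr_ae
    filter_upwards [hLp.coeFn_toLp] with t ht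
    rw [ht]
  simp only [h1] at h
  refine (sum_le_hasSum F (fun k _ => by positivity) h).trans ?_
  have hE : 0 ≤ E := (norm_nonneg _).trans (hb 0)
  have h2 : ∫ t, ‖hLp.toLp f t‖ ^ 2 ≤ ∫ t : UnitAddTorus (Fin 2), E ^ 2 := by
    apply integral_mono_of_nonneg
    · exact ae_of_all _ fun t => by positivity
    · exact integrable_const _
    · filter_upwards [hLp.coeFn_toLp] with t ht
      rw [ht]
      have := hb t
      gcongr
  simpa using h2

lemma torusDist_measurable (y : Torus 2) : Measurable (fun t : Torus 2 => torusDist y t) := by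
  apply Continuous.measurable
  unfold torusDist
  fun_prop

/-- indicator of the disc around a point -/
def dI (r : ℝ) (y : Torus 2) : Torus 2 → ℂ := {t | torusDist y t ≤ r}.indicator (fun _ => 1)

lemma dI_meas (r : ℝ) (y : Torus 2) : Measurable (dI r y) := by
  apply Measurable.indicator measurable_const
  exact measurableSet_le (torusDist_measurable y) measurable_const

lemma dI_norm (r : ℝ) (y t : Torus 2) : ‖dI r y t‖ ≤ 1 := by
  unfold dI
  by_cases h : t ∈ {t | torusDist y t ≤ r} <;> simp [h]

lemma mFourier_add_pt (k : Fin 2 → ℤ) (x y : Torus 2) :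
    mFourier k (x + y) = mFourier k x * mFourier k y := by
  simp only [mFourier, ContinuousMap.coe_mk, Pi.add_apply, ← Finset.prod_mul_distrib]
  congr 1
  ext i
  simp [fourier_apply, smul_add, AddCircle.toCircle_add]

lemma norm_mFourier_pt (k : Fin 2 → ℤ) (x : Torus 2) : ‖mFourier k x‖ = 1 := by
  simp only [mFourier, fourier_apply, ContinuousMap.coe_mk, norm_prod, Circle.norm_coe,
    Finset.prod_const_one]

lemma dI_coeff (r : ℝ) (y : Torus 2) (k : Fin 2 → ℤ) :
    mFourierCoeff (dI r y) k = mFourier (-k) y * mFourierCoeff (dI r 0) k := by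
  unfold mFourierCoeff
  rw [← integral_const_mul, ← integral_add_left_eq_self _ y]
  congr 1
  ext t
  have : dI r y (y + t) = dI r 0 t := by
    unfold dI
    have : torusDist y (y + t) = torusDist 0 t := by
      simp [torusDist]
    simp only [indicator, mem_ofPred_eq, this]
  rw [this, mFourier_add_pt, smul_eq_mul, smul_eq_mul, mul_assoc]

lemma const_coeff (a : ℂ) {k : Fin 2 → ℤ} (hk : k ≠ 0) :
    mFourierCoeff (fun _ : Torus 2 => a) k = 0 := by
  have h := (orthonormal_iff_ite.mp (orthonormal_mFourier (d := Fin 2))) k 0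
  rw [if_neg hk] at h
  rw [ContinuousMap.inner_toLp] at h
  unfold mFourierCoeff
  simp_rw [smul_eq_mul]
  rw [integral_mul_const]
  simp_rw [← mFourier_neg, mFourier_zero] at h
  simp at h
  rw [h, zero_mul]

lemma count_coeff {N : ℕ} (x : Fin N → Torus 2) (r : ℝ) (a : ℂ) {k : Fin 2 → ℤ} (hk : k ≠ 0) :
    mFourierCoeff (fun t => ∑ i, dI r (x i) t - a) k =
      (∑ i, mFourier (-k) (x i)) * mFourierCoeff (dI r 0) k := by
  rw [Finset.sum_mul]
  simp_rw [← dI_coeff]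
  have hIntg : ∀ i, Integrable (fun t => mFourier (-k) t • dI r (x i) t) := by
    intro i
    refine Integrable.of_bound (C := 1) ?_ (ae_of_all _ fun t => ?_)
    · apply AEStronglyMeasurable.mul
      · exact (mFourier (-k)).continuous.aestronglyMeasurable
      · exact (dI_meas r (x i)).aestronglyMeasurable
    · rw [norm_smul, norm_mFourier_pt, one_mul]
      exact dI_norm _ _ _
  have h0 := const_coeff a hk
  unfold mFourierCoeff at h0 ⊢
  rw [← integral_finsetSum _ fun i _ => hIntg i]
  simp_rw [smul_sub, Finset.smul_sum]
  rw [integral_sub, h0, sub_zero]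
  · exact integrable_finsetSum _ fun i _ => hIntg i
  · refine Integrable.of_bound (C := ‖a‖) ?_ (ae_of_all _ fun t => ?_)
    · apply AEStronglyMeasurable.mul
      · exact (mFourier (-k)).continuous.aestronglyMeasurable
      · fun_prop
    · rw [norm_smul, norm_mFourier_pt, one_mul]

lemma mFourier_re (k : Fin 2 → ℤ) (x : Fin 2 → ℝ) :
    (mFourier (-k) (fun i => (x i : UnitAddCircle))).re =
      Real.cos (2 * π * (k 0 * x 0 + k 1 * x 1)) := by
  have : mFourier (-k) (fun i => (x i : UnitAddCircle)) =
      Complex.exp ((-(2 * π * (k 0 * x 0 + k 1 * x 1)) : ℝ) * Complex.I) := by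
    simp only [mFourier, ContinuousMap.coe_mk, Fin.prod_univ_two, fourier_coe_apply]
    rw [← Complex.exp_add]
    congr 1
    simp
    ring
  rw [this, Complex.exp_ofReal_mul_I_re, Real.cos_neg]

lemma dI_coeff_re {r : ℝ} (hr : 0 < r) (hr2 : r ≤ 1/2) {k : Fin 2 → ℤ} (hk : k ≠ 0) :
    (mFourierCoeff (dI r 0) k).re =
      2 * r ^ 2 * gK (2 * π * r * √((k 0 : ℝ) ^ 2 + (k 1 : ℝ) ^ 2)) := by
  have hk' : 0 < (k 0 : ℝ) ^ 2 + (k 1 : ℝ) ^ 2 := by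
    by_contra hh
    push Not at hh
    apply hk
    have h0 : (k 0 : ℝ) = 0 := by nlinarith [sq_nonneg (k 0 : ℝ), sq_nonneg (k 1 : ℝ)]
    have h1 : (k 1 : ℝ) = 0 := by nlinarith [sq_nonneg (k 0 : ℝ), sq_nonneg (k 1 : ℝ)]
    ext i
    fin_cases i
    · simpa using h0
    · simpa using h1
  rw [← disc_pi hr _ _ hk']
  have hbox : MeasurableSet {x : Fin 2 → ℝ | ∀ i, x i ∈ Ioc ((fun _ => -1/2 : Fin 2 → ℝ) i) ((fun _ => -1/2 : Fin 2 → ℝ) i + 1)} :=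
    MeasurableSet.univ_pi' fun i => measurableSet_Ioc
  have hIntg : Integrable (fun t => mFourier (-k) t • dI r 0 t) := by
    refine Integrable.of_bound (C := 1) ?_ (ae_of_all _ fun t => ?_)
    · apply AEStronglyMeasurable.mul
      · exact (mFourier (-k)).continuous.aestronglyMeasurable
      · exact (dI_meas r 0).aestronglyMeasurable
    · rw [norm_smul, norm_mFourier_pt, one_mul]
      exact dI_norm _ _ _
  unfold mFourierCoeff
  have h1 := Complex.reCLM.integral_comp_comm hIntg
  simp only [Complex.reCLM_apply] at h1
  rw [← h1, integral_preimage _ (fun _ => -1/2), ← integral_indicator hbox]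
  apply integral_congr_ae
  have hnull : ∀ i : Fin 2, ∀ᵐ x : Fin 2 → ℝ, x i ≠ -1/2 := fun i => Measure.ae_eval_ne (μ := fun _ => volume) i _
  filter_upwards [hnull 0, hnull 1] with x hx0 hx1
  simp only [indicator, mem_ofPred_eq, dI]
  by_cases hbx : ∀ i, x i ∈ Ioc (-1/2 : ℝ) (-1/2 + 1)
  · rw [if_pos hbx]
    have hn : ∀ i, ‖(x i : UnitAddCircle)‖ = |x i| := by
      intro i
      rw [AddCircle.norm_coe_eq_abs_iff 1 one_ne_zero, abs_le]
      have := hbx i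
      norm_num
      constructor <;> linarith [this.1, this.2]
    have : torusDist 0 (fun i => (x i : AddCircle (1:ℝ))) ≤ r ↔ x 0 ^ 2 + x 1 ^ 2 ≤ r ^ 2 := by
      rw [torusDist, Real.sqrt_le_left hr.le]
      simp only [Pi.zero_apply, zero_sub, norm_neg, Fin.sum_univ_two]
      rw [hn, hn, sq_abs, sq_abs]
    simp only [this]
    split_ifs
    · rw [smul_eq_mul, mul_one, mFourier_re]
    · simp
  · rw [if_neg hbx, if_neg]
    intro hle
    apply hbx
    have h0 : |x 0| ≤ r := abs_le_of_sq_le_sq (by nlinarith [sq_nonneg (x 1)]) hr.le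
    have h1 : |x 1| ≤ r := abs_le_of_sq_le_sq (by nlinarith [sq_nonneg (x 0)]) hr.le
    rw [abs_le] at h0 h1
    intro i
    fin_cases i
    · exact ⟨lt_of_le_of_ne (by simp only [Fin.zero_eta]; linarith) (Ne.symm hx0), by simp only [Fin.zero_eta]; linarith⟩
    · exact ⟨lt_of_le_of_ne (by simp only [Fin.mk_one]; linarith) (Ne.symm hx1), by simp only [Fin.mk_one]; linarith⟩

lemma disc_count {N : ℕ} (x : Fin N → Torus 2) (r : ℝ) (t : Torus 2) :
    ∑ i, dI r (x i) t = (Nat.card {i : Fin N // torusDist (x i) t ≤ r} : ℂ) := by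
  classical
  simp only [dI, indicator, mem_ofPred_eq]
  rw [Finset.sum_boole, Nat.card_eq_fintype_card, Fintype.card_subtype]

lemma disc_bessel {N : ℕ} (x : Fin N → Torus 2) {r E : ℝ} (hr : 0 < r) (hr2 : r ≤ 1/2)
    (h : ∀ t, |(Nat.card {i : Fin N // torusDist (x i) t ≤ r} : ℝ) - N * (π * r ^ 2)| ≤ E)
    (F : Finset (Fin 2 → ℤ)) (hF : 0 ∉ F) :
    ∑ k ∈ F, ‖∑ i, mFourier (-k) (x i)‖ ^ 2 *
      (2 * r ^ 2 * gK (2 * π * r * √((k 0 : ℝ) ^ 2 + (k 1 : ℝ) ^ 2))) ^ 2 ≤ E ^ 2 := by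
  have hb := bessel_torus (fun t => ∑ i, dI r (x i) t - ((N * (π * r ^ 2) : ℝ) : ℂ)) ?_ (E := E) ?_ F
  · refine le_trans (Finset.sum_le_sum fun k hk => ?_) hb
    have hk0 : k ≠ 0 := fun h => hF (h ▸ hk)
    rw [count_coeff x r _ hk0, ← dI_coeff_re hr hr2 hk0, norm_mul, mul_pow]
    gcongr ?_ * ?_
    rw [← sq_abs]
    gcongr
    exact Complex.abs_re_le_norm _
  · apply Measurable.sub_const
    exact Finset.measurable_fun_sum _ fun i _ => dI_meas r (x i)
  · intro t
    rw [disc_count, ← Complex.ofReal_natCast, ← Complex.ofReal_sub, Complex.norm_real]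
    exact h t

end TorusPart


open UnitAddTorus

/-- Poisson kernel on the circle -/
def PK (ρ : ℝ) (θ : UnitAddCircle) : ℝ := (1 - ρ ^ 2) / ‖1 - ρ * (fourier 1 θ : ℂ)‖ ^ 2

lemma norm_fourier_pt (k : ℤ) (θ : UnitAddCircle) : ‖(fourier k θ : ℂ)‖ = 1 := by
  simp only [fourier_apply, Circle.norm_coe]

lemma PK_hasSum {ρ : ℝ} (h0 : 0 < ρ) (h1 : ρ < 1) (θ : UnitAddCircle) :
    HasSum (fun k : ℤ => ((ρ ^ k.natAbs : ℝ) : ℂ) * fourier k θ) (PK ρ θ : ℂ) := by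
  set e : ℂ := fourier 1 θ with he
  have hne : ‖e‖ = 1 := norm_fourier_pt 1 θ
  have hpow : ∀ n : ℕ, (fourier (n : ℤ) θ : ℂ) = e ^ n := by
    intro n
    induction n with
    | zero => simp
    | succ n ih => rw [Nat.cast_succ, fourier_add, ih, pow_succ]
  have hneg : ∀ n : ℕ, (fourier (-(n : ℤ)) θ : ℂ) = (starRingEnd ℂ e) ^ n := by
    intro n
    rw [fourier_neg, hpow, map_pow]
  have hn1 : ‖(ρ : ℂ) * e‖ < 1 := by
    rw [norm_mul, hne, Complex.norm_real, Real.norm_eq_abs, abs_of_pos h0]; linarith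
  have hn2 : ‖(ρ : ℂ) * starRingEnd ℂ e‖ < 1 := by
    rw [norm_mul, RCLike.norm_conj, hne, Complex.norm_real, Real.norm_eq_abs, abs_of_pos h0]; linarith
  have g1 := hasSum_geometric_of_norm_lt_one hn1
  have g2 := (hasSum_geometric_of_norm_lt_one hn2).mul_left ((ρ : ℂ) * starRingEnd ℂ e)
  have hs := HasSum.of_nat_of_neg_add_one (f := fun k : ℤ => ((ρ ^ k.natAbs : ℝ) : ℂ) * fourier k θ)
    (m := (1 - (ρ : ℂ) * e)⁻¹) (m' := ((ρ : ℂ) * starRingEnd ℂ e) * (1 - (ρ : ℂ) * starRingEnd ℂ e)⁻¹)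
    (g1.congr_fun ?_) (g2.congr_fun ?_)
  · convert hs using 1
    have hd1 : (1 - (ρ : ℂ) * e) ≠ 0 := by
      intro h
      rw [sub_eq_zero] at h
      rw [← h] at hn1
      simp at hn1
    have hd2 : (1 - (ρ : ℂ) * starRingEnd ℂ e) ≠ 0 := by
      intro h
      rw [sub_eq_zero] at h
      rw [← h] at hn2
      simp at hn2
    have hee : e * starRingEnd ℂ e = 1 := by
      rw [Complex.mul_conj, Complex.normSq_eq_norm_sq, hne]; simp
    have hnn : ((‖1 - ρ * e‖ ^ 2 : ℝ) : ℂ) = (1 - (ρ : ℂ) * e) * (1 - (ρ : ℂ) * starRingEnd ℂ e) := by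
      rw [← Complex.normSq_eq_norm_sq, ← Complex.mul_conj]
      simp
    rw [PK, Complex.ofReal_div, ← he, hnn]
    field_simp
    push_cast
    linear_combination ((ρ : ℂ) ^ 2) * hee
  · intro n
    simp only [Int.natAbs_natCast]
    rw [hpow, mul_pow]; push_cast; rfl
  · intro n
    have : (-((n : ℤ) + 1)) = -((n + 1 : ℕ) : ℤ) := by push_cast; ring
    simp only [this]
    rw [hneg, Int.natAbs_neg, Int.natAbs_natCast]
    push_cast
    ring

lemma PK_lower {N : ℝ} (hN : 1 < N) (θ : UnitAddCircle) :
    1 / (8 * π ^ 2) * (1 / (1 + N * ‖θ‖ ^ 2)) ≤ 1 / √N * PK (1 - 1 / √N) θ := by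
  have hsq : √N ^ 2 = N := Real.sq_sqrt (by linarith)
  have hs1 : 1 < √N := by
    rw [Real.lt_sqrt (by norm_num)]; linarith
  set δ := 1 / √N with hδ
  have hδ0 : 0 < δ := by positivity
  have hδ1 : δ < 1 := by rw [hδ, div_lt_one (by linarith)]; exact hs1
  have hδN : δ ^ 2 * N = 1 := by rw [hδ, div_pow, hsq]; field_simp
  set e : ℂ := fourier 1 θ with he
  have hne : ‖e‖ = 1 := norm_fourier_pt 1 θ
  have he1 : ‖e - 1‖ ≤ 2 * π * ‖θ‖ := by
    induction θ using QuotientAddGroup.induction_on with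
    | H t =>
      have hq : ‖(t : UnitAddCircle)‖ = |t - round t| := UnitAddCircle.norm_eq
      have hper : ((t - round t : ℝ) : UnitAddCircle) = (t : UnitAddCircle) := by
        rw [AddCircle.coe_sub]
        have : ((round t : ℝ) : UnitAddCircle) = 0 := by
          rw [AddCircle.coe_eq_zero_iff]
          exact ⟨round t, by simp⟩
        rw [this, sub_zero]
      change ‖e - 1‖ ≤ 2 * π * ‖(t : UnitAddCircle)‖
      rw [hq, he]
      change ‖(fourier 1 (t : UnitAddCircle) : ℂ) - 1‖ ≤ _
      rw [← hper, fourier_coe_apply]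
      have := Real.norm_exp_I_mul_ofReal_sub_one_le (x := 2 * π * (t - round t))
      rw [norm_mul, Real.norm_eq_abs, Real.norm_eq_abs, abs_of_pos Real.two_pi_pos] at this
      convert this using 4
      push_cast
      ring_nf
  have hup : ‖1 - ((1 - δ : ℝ) : ℂ) * e‖ ≤ δ + 2 * π * ‖θ‖ := by
    have : 1 - ((1 - δ : ℝ) : ℂ) * e = (δ : ℂ) * e - (e - 1) := by push_cast; ring
    rw [this]
    refine (norm_sub_le _ _).trans ?_
    rw [norm_mul, hne, Complex.norm_real, Real.norm_eq_abs, abs_of_pos hδ0, mul_one]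
    linarith
  have hlow : 0 < ‖1 - ((1 - δ : ℝ) : ℂ) * e‖ := by
    rw [norm_pos_iff]
    intro h
    rw [sub_eq_zero] at h
    have h2 := congrArg norm h
    rw [norm_mul, hne, Complex.norm_real, Real.norm_eq_abs, abs_of_pos (by linarith)] at h2
    simp at h2
    linarith
  have hup2 : ‖1 - ((1 - δ : ℝ) : ℂ) * e‖ ^ 2 ≤ 2 * δ ^ 2 + 8 * π ^ 2 * ‖θ‖ ^ 2 := by
    have : ‖1 - ((1 - δ : ℝ) : ℂ) * e‖ ^ 2 ≤ (δ + 2 * π * ‖θ‖) ^ 2 := by gcongr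
    nlinarith [sq_nonneg (δ - 2 * π * ‖θ‖)]
  unfold PK
  rw [← he, ← mul_div_assoc δ, le_div_iff₀ (by positivity)]
  have h3 : δ ^ 2 ≤ δ * (1 - (1 - δ) ^ 2) := by nlinarith
  refine le_trans ?_ h3
  have hpi : 3 < π := Real.pi_gt_three
  have h4 : 2 * δ ^ 2 + 8 * π ^ 2 * ‖θ‖ ^ 2 ≤ 8 * π ^ 2 * (1 + N * ‖θ‖ ^ 2) * δ ^ 2 := by
    have : 8 * π ^ 2 * (1 + N * ‖θ‖ ^ 2) * δ ^ 2 = 8 * π ^ 2 * δ ^ 2 + 8 * π ^ 2 * ‖θ‖ ^ 2 * (δ ^ 2 * N) := by ring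
    rw [this, hδN, mul_one]
    have : 2 * δ ^ 2 ≤ 8 * π ^ 2 * δ ^ 2 := by gcongr; nlinarith
    linarith
  rw [← mul_div_mul_comm, one_mul, mul_comm, mul_one_div, div_le_iff₀ (by positivity)]
  calc _ ≤ _ := hup2
    _ ≤ _ := h4
    _ = _ := by ring

lemma PK_prod_hasSum {ρ : ℝ} (h0 : 0 < ρ) (h1 : ρ < 1) (θ : Torus 2) :
    HasSum (fun k : Fin 2 → ℤ => ((ρ ^ ((k 0).natAbs + (k 1).natAbs) : ℝ) : ℂ) * mFourier k θ)
      ((PK ρ (θ 0) * PK ρ (θ 1) : ℝ) : ℂ) := by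
  have hA := PK_hasSum h0 h1 (θ 0)
  have hB := PK_hasSum h0 h1 (θ 1)
  have hsum := summable_mul_of_summable_norm hA.summable.norm hB.summable.norm
  have h := hA.mul hB hsum
  rw [← (finTwoArrowEquiv ℤ).hasSum_iff] at h
  rw [Complex.ofReal_mul]
  refine h.congr_fun fun k => ?_
  change _ = (((ρ ^ (k 0).natAbs : ℝ) : ℂ) * fourier (k 0) (θ 0)) *
    (((ρ ^ (k 1).natAbs : ℝ) : ℂ) * fourier (k 1) (θ 1))
  simp only [mFourier, ContinuousMap.coe_mk, Fin.prod_univ_two]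
  rw [pow_add]
  push_cast
  ring

lemma PK_energy {ρ : ℝ} (h0 : 0 < ρ) (h1 : ρ < 1) {N : ℕ} (x : Fin N → Torus 2) :
    HasSum (fun k : Fin 2 → ℤ => ρ ^ ((k 0).natAbs + (k 1).natAbs) * ‖∑ i, mFourier (-k) (x i)‖ ^ 2)
      (∑ i, ∑ j, PK ρ (x i 0 - x j 0) * PK ρ (x i 1 - x j 1)) := by
  have h := hasSum_sum (s := (Finset.univ : Finset (Fin N))) fun i _ =>
    hasSum_sum (s := (Finset.univ : Finset (Fin N))) fun j _ => PK_prod_hasSum h0 h1 (x i - x j)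
  have h2 := Complex.hasSum_re h
  simp only [← Complex.ofReal_sum, Complex.ofReal_re, Pi.sub_apply] at h2
  refine h2.congr_fun fun k => ?_
  simp only [← Finset.mul_sum]
  rw [Complex.re_ofReal_mul]
  congr 1
  have e : ∀ i j, mFourier k (x i - x j) = starRingEnd ℂ (mFourier (-k) (x i)) * mFourier (-k) (x j) := by
    intro i j
    rw [← mFourier_neg, neg_neg]
    have h3 : mFourier k (x i) = mFourier k (x i - x j) * mFourier k (x j) := by
      rw [← mFourier_add_pt, sub_add_cancel]
    rw [h3, mul_assoc, ← mFourier_add]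
    simp [mFourier_zero]
  simp_rw [e, ← Finset.mul_sum, ← Finset.sum_mul, ← map_sum]
  rw [← Complex.normSq_eq_conj_mul_self, Complex.ofReal_re, Complex.normSq_eq_norm_sq]

lemma energy_term {N : ℝ} (hN : 1 < N) (x y : Torus 2) :
    1 / (1 + N ^ 2 * torusDist x y ^ 4) ≤
      128 * π ^ 4 * ((1 / √N) ^ 2 * (PK (1 - 1 / √N) (x 0 - y 0) * PK (1 - 1 / √N) (x 1 - y 1))) := by
  have ha := PK_lower hN (x 0 - y 0)
  have hb := PK_lower hN (x 1 - y 1)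
  have hd : torusDist x y ^ 4 = (‖x 0 - y 0‖ ^ 2 + ‖x 1 - y 1‖ ^ 2) ^ 2 := by
    rw [torusDist, show (4:ℕ) = 2 * 2 by norm_num, pow_mul, Real.sq_sqrt (by positivity), Fin.sum_univ_two]
  rw [hd]
  set u := ‖x 0 - y 0‖ ^ 2
  set v := ‖x 1 - y 1‖ ^ 2
  have hu : 0 ≤ u := by positivity
  have hv : 0 ≤ v := by positivity
  have hN0 : 0 < N := by linarith
  have hm := mul_le_mul ha hb (by positivity) (le_trans (by positivity) ha)
  have h1 : 1 / (1 + N ^ 2 * (u + v) ^ 2) ≤ 2 * (1 / (1 + N * u) * (1 / (1 + N * v))) := by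
    rw [← mul_div_mul_comm, one_mul, mul_one_div, div_le_div_iff₀ (by positivity) (by positivity)]
    nlinarith [sq_nonneg (N * (u + v) - 1), sq_nonneg (N * (u - v))]
  have hpi : 0 < π := Real.pi_pos
  calc _ ≤ _ := h1
    _ = 128 * π ^ 4 * (1 / (8 * π ^ 2) * (1 / (1 + N * u)) * (1 / (8 * π ^ 2) * (1 / (1 + N * v)))) := by
      field_simp; norm_num
    _ ≤ _ := by
      gcongr 128 * π ^ 4 * ?_
      refine hm.trans_eq ?_
      ring

lemma weight_bound {δ : ℝ} (h0 : 0 < δ) (h1 : δ < 1) {k : Fin 2 → ℤ}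
    (hK : 0 < √((k 0 : ℝ) ^ 2 + (k 1 : ℝ) ^ 2)) :
    δ ^ 2 * (1 - δ) ^ ((k 0).natAbs + (k 1).natAbs) ≤
      6 / δ * (1 / √((k 0 : ℝ) ^ 2 + (k 1 : ℝ) ^ 2) ^ 3) := by
  set K := √((k 0 : ℝ) ^ 2 + (k 1 : ℝ) ^ 2) with hKd
  set m := (k 0).natAbs + (k 1).natAbs with hm
  have hmc : (m : ℝ) = |(k 0 : ℝ)| + |(k 1 : ℝ)| := by
    rw [hm]; push_cast; simp [Nat.cast_natAbs]
  have hKm : K ≤ m := by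
    rw [hKd, hmc]
    apply Real.sqrt_le_iff.2
    refine ⟨by positivity, ?_⟩
    rw [add_sq, sq_abs, sq_abs]
    nlinarith [mul_nonneg (abs_nonneg (k 0 : ℝ)) (abs_nonneg (k 1 : ℝ))]
  have h2 : (1 - δ) ^ m ≤ Real.exp (-(δ * m)) := by
    have : 1 - δ ≤ Real.exp (-δ) := by linarith [Real.add_one_le_exp (-δ)]
    calc (1 - δ) ^ m ≤ Real.exp (-δ) ^ m := by gcongr
      _ = Real.exp (-(δ * m)) := by rw [← Real.exp_nat_mul]; congr 1; ring
  have h3 : (δ * K) ^ 3 / 6 ≤ Real.exp (δ * m) := by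
    have := Real.pow_div_factorial_le_exp (δ * K) (by positivity) 3
    norm_num [Nat.factorial] at this
    refine this.trans ?_
    gcongr
  have h4 : Real.exp (-(δ * m)) ≤ 6 / (δ * K) ^ 3 := by
    rw [Real.exp_neg, inv_le_comm₀ (Real.exp_pos _) (by positivity), inv_div]
    exact h3
  calc δ ^ 2 * (1 - δ) ^ m ≤ δ ^ 2 * (6 / (δ * K) ^ 3) := by gcongr; exact h2.trans h4
    _ = _ := by field_simp


lemma one_le_K {k : Fin 2 → ℤ} (hk : k ≠ 0) : 1 ≤ √((k 0 : ℝ) ^ 2 + (k 1 : ℝ) ^ 2) := by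
  rw [Real.one_le_sqrt]
  have : 1 ≤ (k 0) ^ 2 + (k 1) ^ 2 := by
    by_contra hh
    apply hk
    have h0 : k 0 = 0 := by nlinarith [sq_nonneg (k 0), sq_nonneg (k 1)]
    have h1 : k 1 = 0 := by nlinarith [sq_nonneg (k 0), sq_nonneg (k 1)]
    ext i
    fin_cases i
    · exact h0
    · exact h1
  exact_mod_cast this


lemma weighted_sum_bound {c0 : ℝ} (hc0 : 0 < c0)
    (hg : ∀ z : ℝ, π / 2 ≤ z → c0 / z ^ 3 ≤ gK z ^ 2 + gK (2 * z) ^ 2)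
    {N : ℕ} (x : Fin N → Torus 2) {E : ℝ}
    (h : ∀ (center : Torus 2) (r : ℝ), (r = 1/4 ∨ r = 1/2) →
        |(Nat.card {i : Fin N // torusDist (x i) center ≤ r} : ℝ) - N * (π * r ^ 2)| ≤ E)
    (F : Finset (Fin 2 → ℤ)) (hF : 0 ∉ F) :
    ∑ k ∈ F, 1 / √((k 0 : ℝ) ^ 2 + (k 1 : ℝ) ^ 2) ^ 3 * ‖∑ i, mFourier (-k) (x i)‖ ^ 2 ≤
      16 * π ^ 3 / c0 * E ^ 2 := by
  have b1 := disc_bessel x (r := 1/4) (by norm_num) (by norm_num) (fun t => h t _ (Or.inl rfl)) F hF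
  have b2 := disc_bessel x (r := 1/2) (by norm_num) (by norm_num) (fun t => h t _ (Or.inr rfl)) F hF
  have hpi := Real.pi_pos
  have key : ∀ k ∈ F, 1 / √((k 0 : ℝ) ^ 2 + (k 1 : ℝ) ^ 2) ^ 3 * ‖∑ i, mFourier (-k) (x i)‖ ^ 2 ≤
      8 * π ^ 3 / c0 * (‖∑ i, mFourier (-k) (x i)‖ ^ 2 *
      (2 * (1/4) ^ 2 * gK (2 * π * (1/4) * √((k 0 : ℝ) ^ 2 + (k 1 : ℝ) ^ 2))) ^ 2 +
      ‖∑ i, mFourier (-k) (x i)‖ ^ 2 *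
      (2 * (1/2) ^ 2 * gK (2 * π * (1/2) * √((k 0 : ℝ) ^ 2 + (k 1 : ℝ) ^ 2))) ^ 2) := by
    intro k hk
    have hK := one_le_K (k := k) fun h => hF (h ▸ hk)
    set K := √((k 0 : ℝ) ^ 2 + (k 1 : ℝ) ^ 2)
    set S := ‖∑ i, mFourier (-k) (x i)‖ ^ 2
    have hS : 0 ≤ S := by positivity
    have h1 := hg (π / 2 * K) (by nlinarith)
    rw [show 2 * π * (1/4) * K = π / 2 * K by ring, show 2 * π * (1/2) * K = 2 * (π / 2 * K) by ring]
    set g1 := gK (π / 2 * K)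
    set g2 := gK (2 * (π / 2 * K))
    have h2 : c0 / (8 * π ^ 3) * (1 / K ^ 3) ≤ (2 * (1/4) ^ 2 * g1) ^ 2 + (2 * (1/2) ^ 2 * g2) ^ 2 := by
      have e : c0 / (8 * π ^ 3) * (1 / K ^ 3) = 1 / 64 * (c0 / (π / 2 * K) ^ 3) := by
        field_simp; norm_num
      rw [e]
      nlinarith [sq_nonneg g2]
    calc 1 / K ^ 3 * S = 8 * π ^ 3 / c0 * (S * (c0 / (8 * π ^ 3) * (1 / K ^ 3))) := by field_simp
      _ ≤ 8 * π ^ 3 / c0 * (S * ((2 * (1/4) ^ 2 * g1) ^ 2 + (2 * (1/2) ^ 2 * g2) ^ 2)) := by gcongr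
      _ = _ := by ring
  refine (Finset.sum_le_sum key).trans ?_
  rw [← Finset.mul_sum, Finset.sum_add_distrib]
  calc _ ≤ 8 * π ^ 3 / c0 * (E ^ 2 + E ^ 2) := by gcongr
    _ = _ := by ring

/-- Consequence of Theorem 1 (Section 1.3): if every disk of radius 1/4 or 1/2 contains
`N·πr² ± c N^{1/4} √(log N)` points, then the Riesz-type energy is `≲ N log N`. -/
theorem energy_bound_from_discrepancy (c : ℝ) (hc : 0 < c) :
    ∃ C : ℝ, 0 < C ∧ ∀ (N : ℕ), 2 ≤ N → ∀ x : Fin N → Torus 2,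
      (∀ (center : Torus 2) (r : ℝ), (r = 1/4 ∨ r = 1/2) →
        |(Nat.card {i : Fin N // torusDist (x i) center ≤ r} : ℝ) - N * (π * r ^ 2)| ≤
          c * (N : ℝ) ^ ((1:ℝ)/4) * Real.sqrt (Real.log N)) →
      ∑ i, ∑ j, 1 / (1 + (N : ℝ) ^ 2 * torusDist (x i) (x j) ^ 4) ≤
        C * N * Real.log N := by
  obtain ⟨c0, hc0, hg⟩ := gK_lower
  have hpi := Real.pi_pos
  refine ⟨128 * π ^ 4 * (2 + 96 * π ^ 3 * c ^ 2 / c0), by positivity, ?_⟩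
  intro N hN x h
  have hN2 : (2 : ℝ) ≤ N := by exact_mod_cast hN
  have hN1 : (1 : ℝ) < N := by linarith
  have hN0 : (0 : ℝ) < N := by linarith
  have hlog : 1 / 2 ≤ Real.log N := by
    have := Real.log_le_log (by norm_num) hN2
    linarith [Real.log_two_gt_d9]
  have hs1 : 1 < √(N : ℝ) := by
    rw [Real.lt_sqrt (by norm_num)]; linarith
  have hsq : √(N : ℝ) ^ 2 = N := Real.sq_sqrt hN0.le
  have hE2 : (c * (N : ℝ) ^ ((1:ℝ)/4) * √(Real.log N)) ^ 2 = c ^ 2 * √(N : ℝ) * Real.log N := by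
    rw [mul_pow, mul_pow, Real.sq_sqrt (by linarith), ← Real.rpow_natCast ((N : ℝ) ^ ((1:ℝ)/4)) 2,
      ← Real.rpow_mul hN0.le, Real.sqrt_eq_rpow]
    norm_num
  have hδ1 : 1 / √(N : ℝ) < 1 := by rw [div_lt_one (by linarith)]; exact hs1
  have hδ0 : 0 < 1 / √(N : ℝ) := by positivity
  have hsum := (PK_energy (ρ := 1 - 1 / √(N : ℝ)) (by linarith) (by linarith) x).mul_left ((1 / √(N : ℝ)) ^ 2)
  have hbound : (1 / √(N : ℝ)) ^ 2 * ∑ i, ∑ j, PK (1 - 1 / √(N : ℝ)) (x i 0 - x j 0) *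
      PK (1 - 1 / √(N : ℝ)) (x i 1 - x j 1) ≤ (2 + 96 * π ^ 3 * c ^ 2 / c0) * N * Real.log N := by
    refine hasSum_le_of_sum_le hsum fun F => ?_
    have hnn : ∀ k : Fin 2 → ℤ, 0 ≤ (1 / √(N : ℝ)) ^ 2 * ((1 - 1 / √(N : ℝ)) ^ ((k 0).natAbs + (k 1).natAbs) *
        ‖∑ i, mFourier (-k) (x i)‖ ^ 2) := by
      intro k
      have : 0 ≤ 1 - 1 / √(N : ℝ) := by linarith
      positivity
    classical
    have h1 : ∑ k ∈ F, (1 / √(N : ℝ)) ^ 2 * ((1 - 1 / √(N : ℝ)) ^ ((k 0).natAbs + (k 1).natAbs) *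
        ‖∑ i, mFourier (-k) (x i)‖ ^ 2) ≤ ∑ k ∈ insert 0 (F.erase 0), (1 / √(N : ℝ)) ^ 2 *
        ((1 - 1 / √(N : ℝ)) ^ ((k 0).natAbs + (k 1).natAbs) * ‖∑ i, mFourier (-k) (x i)‖ ^ 2) := by
      apply Finset.sum_le_sum_of_subset_of_nonneg
      · intro k hk
        by_cases hk0 : k = 0
        · simp [hk0]
        · simp [hk0, hk]
      · intro k _ _; exact hnn k
    refine h1.trans ?_
    rw [Finset.sum_insert (by simp)]
    have hz : (1 / √(N : ℝ)) ^ 2 * ((1 - 1 / √(N : ℝ)) ^ (((0 : Fin 2 → ℤ) 0).natAbs + ((0 : Fin 2 → ℤ) 1).natAbs) *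
        ‖∑ i, mFourier (-(0 : Fin 2 → ℤ)) (x i)‖ ^ 2) = N := by
      simp [mFourier_zero]
      field_simp
    rw [hz]
    have hw := weighted_sum_bound hc0 hg x h (F.erase 0) (by simp)
    rw [hE2] at hw
    have h2 : ∑ k ∈ F.erase 0, (1 / √(N : ℝ)) ^ 2 *
        ((1 - 1 / √(N : ℝ)) ^ ((k 0).natAbs + (k 1).natAbs) * ‖∑ i, mFourier (-k) (x i)‖ ^ 2) ≤
        6 * √(N : ℝ) * (16 * π ^ 3 / c0 * (c ^ 2 * √(N : ℝ) * Real.log N)) := by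
      refine le_trans ?_ (mul_le_mul_of_nonneg_left hw (by positivity))
      rw [Finset.mul_sum]
      refine Finset.sum_le_sum fun k hk => ?_
      have hK := one_le_K (k := k) (Finset.ne_of_mem_erase hk)
      have := weight_bound hδ0 hδ1 (k := k) (by linarith)
      rw [← mul_assoc, ← mul_assoc]
      refine mul_le_mul_of_nonneg_right (this.trans_eq ?_) (by positivity)
      field_simp
    have e : 6 * √(N : ℝ) * (16 * π ^ 3 / c0 * (c ^ 2 * √(N : ℝ) * Real.log N)) =
        96 * π ^ 3 * c ^ 2 / c0 * N * Real.log N := by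
      calc _ = 96 * π ^ 3 * c ^ 2 / c0 * √(N : ℝ) ^ 2 * Real.log N := by ring
        _ = _ := by rw [hsq]
    rw [e] at h2
    nlinarith
  calc _ ≤ ∑ i, ∑ j, 128 * π ^ 4 * ((1 / √(N : ℝ)) ^ 2 * (PK (1 - 1 / √(N : ℝ)) (x i 0 - x j 0) *
        PK (1 - 1 / √(N : ℝ)) (x i 1 - x j 1))) :=
      Finset.sum_le_sum fun i _ => Finset.sum_le_sum fun j _ => energy_term hN1 (x i) (x j)
    _ = 128 * π ^ 4 * ((1 / √(N : ℝ)) ^ 2 * ∑ i, ∑ j, PK (1 - 1 / √(N : ℝ)) (x i 0 - x j 0) *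
        PK (1 - 1 / √(N : ℝ)) (x i 1 - x j 1)) := by simp only [Finset.mul_sum]
    _ ≤ 128 * π ^ 4 * ((2 + 96 * π ^ 3 * c ^ 2 / c0) * N * Real.log N) := by gcongr
    _ = _ := by ring
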